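/- arXiv:2311.11429 — 2 statements merged into one kernel-verified Lean document; each statement's English description precedes it below -/
import Mathlib

section
/- For all natural numbers d and r, there exists a function c : ℕ → ℤ such that for all finite sets A, B of vectors in {-1,1}^d and all real weight functions a : A → ℝ and b : B → ℝ, Σ_{x ∈ A} Σ_{y ∈ B} a(x)·b(y)·( Σ_{i=1}^d x_i·y_i )^r = Σ_{M ⊆ [d], |M| ≤ r} c(|M|) · ( Σ_{x ∈ A} a(x)·Π_{i ∈ M} x_i ) · ( Σ_{y ∈ B} b(y)·Π_{i ∈ M} y_i ), where the outer sum on the right ranges over all subsets M of [d] of cardinality at most r. -/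
open scoped symmDiff in
/-- Toggling the membership of `i` in `M` multiplies a product of signs over `M` by the sign
at `i`. -/
theorem prod_symmDiff_singleton_of_sq_eq_one {ι R : Type*} [DecidableEq ι] [CommRing R]
    {z : ι → R} (hz : ∀ i, z i * z i = 1) (M : Finset ι) (i : ι) :
    ∏ j ∈ M ∆ {i}, z j = (∏ j ∈ M, z j) * z i := by
  by_cases hi : i ∈ M
  · have h : M ∆ {i} = M.erase i := by
      ext j; simp only [Finset.mem_symmDiff, Finset.mem_singleton, Finset.mem_erase]; grind
    rw [h, ← Finset.mul_prod_erase M z hi]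
    linear_combination (-∏ j ∈ M.erase i, z j) * hz i
  · have h : M ∆ {i} = insert i M := by
      ext j; simp only [Finset.mem_symmDiff, Finset.mem_singleton, Finset.mem_insert]; grind
    rw [h, Finset.prod_insert hi, mul_comm]

open scoped symmDiff in
/-- Summing a function of the cardinality over all one-element modifications of `M`. -/
theorem sum_card_symmDiff_singleton {ι : Type*} [Fintype ι] [DecidableEq ι] (c : ℕ → ℤ)
    (M : Finset ι) :
    ∑ i, c (M ∆ {i}).card =
      M.card * c (M.card - 1) + (Fintype.card ι - M.card) * c (M.card + 1) := by
  rw [← Finset.sum_add_sum_compl M]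
  have hin : ∀ i ∈ M, c (M ∆ {i}).card = c (M.card - 1) := fun i hi => by
    have h : M ∆ {i} = M.erase i := by
      ext j; simp only [Finset.mem_symmDiff, Finset.mem_singleton, Finset.mem_erase]; grind
    rw [h, Finset.card_erase_of_mem hi]
  have hout : ∀ i ∈ Mᶜ, c (M ∆ {i}).card = c (M.card + 1) := fun i hi => by
    rw [Finset.mem_compl] at hi
    have h : M ∆ {i} = insert i M := by
      ext j; simp only [Finset.mem_symmDiff, Finset.mem_singleton, Finset.mem_insert]; grind
    rw [h, Finset.card_insert_of_notMem hi]
  rw [Finset.sum_congr rfl hin, Finset.sum_congr rfl hout, Finset.sum_const, Finset.sum_const,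
    Finset.card_compl, nsmul_eq_mul, nsmul_eq_mul, Nat.cast_sub M.card_le_univ]

open scoped symmDiff in
/-- A power of a sum of signs expands into multilinear monomials, with integer coefficients
depending only on the degree of the monomial and vanishing above the exponent. -/
theorem exists_sum_pow_eq_sum_card_mul_prod (ι R : Type*) [Fintype ι] [CommRing R] (r : ℕ) :
    ∃ c : ℕ → ℤ, (∀ m, r < m → c m = 0) ∧ ∀ z : ι → R, (∀ i, z i * z i = 1) →
      (∑ i, z i) ^ r = ∑ M : Finset ι, (c M.card : R) * ∏ i ∈ M, z i := by
  classical
  induction r with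
  | zero =>
    refine ⟨fun m => if m = 0 then 1 else 0, fun m hm => if_neg hm.ne', fun z _ => ?_⟩
    simp [Finset.card_eq_zero]
  | succ r ih =>
    obtain ⟨c, hc, h⟩ := ih
    refine ⟨fun m => m * c (m - 1) + (Fintype.card ι - m) * c (m + 1), fun m hm => ?_,
      fun z hz => ?_⟩
    · simp only [hc (m - 1) (by omega), hc (m + 1) (by omega), mul_zero, add_zero]
    · calc (∑ i, z i) ^ (r + 1)
          = ∑ i, ∑ M : Finset ι, (c M.card : R) * ∏ j ∈ M ∆ {i}, z j := by
            simp_rw [pow_succ, h z hz, Finset.mul_sum, Finset.sum_mul,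
              prod_symmDiff_singleton_of_sq_eq_one hz, mul_assoc]
        _ = ∑ i, ∑ M : Finset ι, (c (M ∆ {i}).card : R) * ∏ j ∈ M, z j := by
            refine Finset.sum_congr rfl fun i _ => ?_
            refine Finset.sum_bij' (fun M _ => M ∆ {i}) (fun M _ => M ∆ {i}) ?_ ?_ ?_ ?_ ?_ <;>
              simp [symmDiff_symmDiff_cancel_right]
        _ = _ := by
            rw [Finset.sum_comm]
            refine Finset.sum_congr rfl fun M _ => ?_
            rw [← Finset.sum_mul, ← Int.cast_sum, sum_card_symmDiff_singleton]

/-- The group-pair score rearrangement: there are integer coefficients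
depending only on the degree such that for all finite sets `A, B ⊆ {-1,1}^d` and all
weights `a, b`,
`Σ_{x ∈ A} Σ_{y ∈ B} a(x)·b(y)·⟨x,y⟩^r
  = Σ_{|M| ≤ r} c(|M|)·(Σ_{x ∈ A} a(x)·x_M)·(Σ_{y ∈ B} b(y)·y_M)`. -/
theorem score_rearrangement
    (d r : ℕ) :
    ∃ c : ℕ → ℤ,
      ∀ A B : Finset (Fin d → ℝ),
        (∀ x ∈ A, ∀ i, x i = 1 ∨ x i = -1) →
        (∀ y ∈ B, ∀ i, y i = 1 ∨ y i = -1) →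
        ∀ a b : (Fin d → ℝ) → ℝ,
          ∑ x ∈ A, ∑ y ∈ B, a x * b y * (∑ i, x i * y i) ^ r =
            ∑ M ∈ Finset.univ.filter (fun M : Finset (Fin d) => M.card ≤ r),
              (c M.card : ℝ) * (∑ x ∈ A, a x * ∏ i ∈ M, x i) *
                (∑ y ∈ B, b y * ∏ i ∈ M, y i) := by
  obtain ⟨c, hc, h⟩ := exists_sum_pow_eq_sum_card_mul_prod (Fin d) ℝ r
  refine ⟨c, fun A B hA hB a b => ?_⟩
  have hz : ∀ x ∈ A, ∀ y ∈ B, ∀ i, x i * y i * (x i * y i) = 1 := fun x hx y hy i => by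
    rcases hA x hx i with h₁ | h₁ <;> rcases hB y hy i with h₂ | h₂ <;> simp [h₁, h₂]
  calc ∑ x ∈ A, ∑ y ∈ B, a x * b y * (∑ i, x i * y i) ^ r
      = ∑ x ∈ A, ∑ y ∈ B, ∑ M : Finset (Fin d),
          (c M.card : ℝ) * (a x * ∏ i ∈ M, x i) * (b y * ∏ i ∈ M, y i) := by
        refine Finset.sum_congr rfl fun x hx => Finset.sum_congr rfl fun y hy => ?_
        rw [h _ (hz x hx y hy), Finset.mul_sum]
        refine Finset.sum_congr rfl fun M _ => ?_
        rw [Finset.prod_mul_distrib]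
        ring
    _ = ∑ M : Finset (Fin d), (c M.card : ℝ) * (∑ x ∈ A, a x * ∏ i ∈ M, x i) *
          (∑ y ∈ B, b y * ∏ i ∈ M, y i) := by
        simp_rw [mul_assoc (c _ : ℝ), Finset.sum_mul_sum, Finset.mul_sum]
        rw [Finset.sum_comm (s := Finset.univ)]
        exact Finset.sum_congr rfl fun x _ => Finset.sum_comm
    _ = _ := by
        refine (Finset.sum_filter_of_ne fun M _ hM => ?_).symm
        contrapose! hM
        simp [hc _ hM]
end

section
/- For every real ε > 0 and all real constants c > 0 and τ ≥ 1, there exists a real w > 1 and a natural number N such that for every natural number n ≥ N, setting d = ⌈c·w²·log n⌉ and r = ⌈log_w(τ·n^{1/3})⌉, one has Σ_{i=0}^{r} C(d,i) ≤ n^{2/3 + ε} and Σ_{i=0}^{⌈r/2⌉} C(d,i) ≤ n^{1/3 + ε}. -/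
/-- The number of subsets of size at most `k` of a `d`-element set is at most
`x ^ k * (1 + 1 / x) ^ d`, here in exponential form. -/
theorem sum_choose_le_exp (d k : ℕ) {x : ℝ} (hx : 1 ≤ x) :
    ((∑ i ∈ Finset.range (k + 1), Nat.choose d i : ℕ) : ℝ)
      ≤ Real.exp (k * Real.log x + d / x) := by
  have hx0 : 0 < x := by linarith
  have hterm : ∀ i ∈ Finset.range (k + 1),
      (Nat.choose d i : ℝ) ≤ x ^ k * ((x⁻¹) ^ i * Nat.choose d i) := by
    intro i hi
    have hik : i ≤ k := by simpa [Nat.lt_succ_iff] using hi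
    have h1 : 1 ≤ x ^ k * (x⁻¹) ^ i := by
      rw [inv_pow, ← div_eq_mul_inv, one_le_div (by positivity)]
      exact pow_le_pow_right₀ hx hik
    nlinarith [(Nat.cast_nonneg (Nat.choose d i) : (0 : ℝ) ≤ _)]
  have hbinom : ∑ i ∈ Finset.range (k + 1), (x⁻¹) ^ i * (Nat.choose d i : ℝ)
      ≤ (x⁻¹ + 1) ^ d := by
    have hext : ∑ i ∈ Finset.range (d + 1), (x⁻¹) ^ i * (Nat.choose d i : ℝ)
        = ∑ i ∈ Finset.range (d + 1 + k), (x⁻¹) ^ i * (Nat.choose d i : ℝ) := by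
      refine Finset.sum_subset (Finset.range_subset_range.2 (by omega)) fun i _ hi => ?_
      rw [Nat.choose_eq_zero_of_lt (by rw [Finset.mem_range] at hi; omega)]
      simp
    rw [add_pow]
    simp only [one_pow, mul_one]
    rw [hext]
    exact Finset.sum_le_sum_of_subset_of_nonneg (Finset.range_subset_range.2 (by omega))
      fun i _ _ => by positivity
  calc ((∑ i ∈ Finset.range (k + 1), Nat.choose d i : ℕ) : ℝ)
      ≤ x ^ k * ∑ i ∈ Finset.range (k + 1), (x⁻¹) ^ i * (Nat.choose d i : ℝ) := by
        rw [Nat.cast_sum, Finset.mul_sum]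
        exact Finset.sum_le_sum hterm
    _ ≤ x ^ k * (Real.exp x⁻¹) ^ d := by
        gcongr
        exact hbinom.trans (pow_le_pow_left₀ (by positivity) (Real.add_one_le_exp _) d)
    _ = Real.exp (k * Real.log x + d / x) := by
        rw [Real.exp_add, Real.exp_nat_mul, Real.exp_log hx0, ← Real.exp_nat_mul,
          div_eq_mul_inv]

/-- For every `ε > 0`, `c > 0` and `τ ≥ 1`, there exist a real `w > 1` and
`N : ℕ` such that for all `n ≥ N`, setting `d = ⌈c·w²·log n⌉` and
`r = ⌈log_w(τ·n^{1/3})⌉`, the number of subsets of `[d]` of size at most `r` is at most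
`n^{2/3+ε}` and the number of subsets of size at most `⌈r/2⌉` is at most `n^{1/3+ε}`. -/
theorem subset_count_bound
    (ε c τ : ℝ) (hε : 0 < ε) (hc : 0 < c) (hτ : 1 ≤ τ) :
    ∃ w : ℝ, 1 < w ∧ ∃ N : ℕ, ∀ n : ℕ, N ≤ n →
      ∀ d r : ℕ,
        d = ⌈c * w ^ 2 * Real.log n⌉₊ →
        r = ⌈Real.log (τ * (n : ℝ) ^ ((1 : ℝ) / 3)) / Real.log w⌉₊ →
        ((∑ i ∈ Finset.range (r + 1), Nat.choose d i : ℕ) : ℝ)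
            ≤ (n : ℝ) ^ ((2 : ℝ) / 3 + ε) ∧
        ((∑ i ∈ Finset.range (⌈(r : ℝ) / 2⌉₊ + 1), Nat.choose d i : ℕ) : ℝ)
            ≤ (n : ℝ) ^ ((1 : ℝ) / 3 + ε) := by
  set A : ℝ := 1 + 3 * c / ε with hA
  have hA1 : 1 ≤ A := by rw [hA]; linarith [show 0 ≤ 3 * c / ε by positivity]
  have hA0 : 0 < A := by linarith
  have hlA : 0 ≤ Real.log A := Real.log_nonneg hA1
  set l : ℝ := 1 + Real.log A / ε with hl
  have hl0 : 0 < l := by positivity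
  have hlA_le : Real.log A ≤ ε * l := by
    rw [hl, mul_add, mul_div_cancel₀ _ hε.ne']; linarith
  have hcA : c ≤ ε / 3 * A := by
    have h : ε * A = ε + 3 * c := by rw [hA]; field_simp
    linarith
  set w : ℝ := Real.exp l with hw
  have hw1 : 1 < w := Real.one_lt_exp_iff.2 hl0
  have hlw : Real.log w = l := Real.log_exp l
  set x : ℝ := A * w ^ 2 with hx
  have hx1 : 1 ≤ x := one_le_mul_of_one_le_of_one_le hA1 (one_le_pow₀ hw1.le)
  have hlx : Real.log x = Real.log A + 2 * l := by
    rw [hx, Real.log_mul hA0.ne' (by positivity), Real.log_pow, hlw]; norm_num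
  have hlx0 : 0 ≤ Real.log x := Real.log_nonneg hx1
  have hlxl : Real.log x / l ≤ 2 + ε := by
    rw [div_le_iff₀ hl0, hlx]; linarith
  have hτ0 : 0 ≤ Real.log τ := Real.log_nonneg hτ
  set K : ℝ := (Real.log τ / l + 2) * Real.log x + 1 with hK
  refine ⟨w, hw1, ⌈Real.exp (3 * K / ε)⌉₊, ?_⟩
  rintro n hn d r hd hr
  have hn' : Real.exp (3 * K / ε) ≤ n := Nat.ceil_le.1 hn
  have hn0 : (0 : ℝ) < n := (Real.exp_pos _).trans_le hn'
  set L : ℝ := Real.log n with hL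
  have hKL : K ≤ ε / 3 * L := by
    have h := (Real.le_log_iff_exp_le hn0).2 hn'
    rw [div_le_iff₀ hε] at h
    linarith
  have hL0 : 0 ≤ L := Real.log_natCast_nonneg n
  have hdx : (d : ℝ) / x ≤ ε / 3 * L + 1 := by
    have h : (d : ℝ) ≤ c * w ^ 2 * L + 1 := hd ▸ (Nat.ceil_lt_add_one (by positivity)).le
    rw [div_le_iff₀ (by linarith)]
    have h2 : c * (w ^ 2 * L) ≤ ε / 3 * A * (w ^ 2 * L) := by gcongr
    have h3 : ε / 3 * L * x = ε / 3 * A * (w ^ 2 * L) := by rw [hx]; ring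
    linarith
  have hlog : Real.log (τ * (n : ℝ) ^ ((1 : ℝ) / 3)) = Real.log τ + 1 / 3 * L := by
    rw [Real.log_mul (by linarith) (by positivity), Real.log_rpow hn0]
  have hr' : (r : ℝ) ≤ (Real.log τ + 1 / 3 * L) / l + 1 := by
    rw [hr, hlog, hlw]
    exact (Nat.ceil_lt_add_one (by positivity)).le
  have hk' : (⌈(r : ℝ) / 2⌉₊ : ℝ) ≤ r / 2 + 1 := (Nat.ceil_lt_add_one (by positivity)).le
  have hT : 0 ≤ Real.log τ / l * Real.log x := by positivity
  have hLl : L * (Real.log x / l) ≤ L * (2 + ε) := by gcongr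
  have hrx : r * Real.log x
      ≤ Real.log τ / l * Real.log x + 1 / 3 * (L * (Real.log x / l)) + Real.log x := by
    calc r * Real.log x ≤ ((Real.log τ + 1 / 3 * L) / l + 1) * Real.log x := by gcongr
      _ = _ := by ring
  have hkx : (⌈(r : ℝ) / 2⌉₊ : ℝ) * Real.log x ≤ r * Real.log x / 2 + Real.log x := by
    calc (⌈(r : ℝ) / 2⌉₊ : ℝ) * Real.log x ≤ (r / 2 + 1) * Real.log x := by gcongr
      _ = _ := by ring
  have hεL : 0 ≤ ε * L := by positivity
  constructor
  · refine (sum_choose_le_exp d r hx1).trans ?_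
    rw [Real.rpow_def_of_pos hn0, ← hL, Real.exp_le_exp]
    linarith
  · refine (sum_choose_le_exp d _ hx1).trans ?_
    rw [Real.rpow_def_of_pos hn0, ← hL, Real.exp_le_exp]
    linarith
end
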